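/- Local inversion with polynomial denominators: Let V : ℂ^{r₁} × ℂ^{r₂} → ℂ^N (r₂ ≥ N) be holomorphic near 0 with V(x, 0) ≡ 0, and suppose the N×N minor det(∂V/∂ξ')(x,0) (ξ = (ξ',ξ''), ξ' ∈ ℂ^N) is not identically zero. Then there exist a holomorphic function δ : ℂ^{r₁} → ℂ with δ ≢ 0 and a holomorphic map φ : ℂ^{r₁} × ℂ^N → ℂ^{r₂} with φ(·,0)=0 such that V(x, φ(x, Z/δ(x))) = Z for all (x, Z) with δ(x) ≠ 0 and x, Z/δ(x) sufficiently small. Moreover one may take δ(x) = (det ∂V/∂ξ'(x,0))². -/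

import Mathlib

open Filter Topology

theorem AnalyticAt.apply_clm {E F G : Type*} [NormedAddCommGroup E] [NormedSpace ℂ E]
    [NormedAddCommGroup F] [NormedSpace ℂ F] [NormedAddCommGroup G] [NormedSpace ℂ G]
    {c : E → F →L[ℂ] G} {u : E → F} {x : E} (hc : AnalyticAt ℂ c x) (hu : AnalyticAt ℂ u x) :
    AnalyticAt ℂ (fun y => c y (u y)) x :=
  ((ContinuousLinearMap.id ℂ (F →L[ℂ] G)).analyticAt_bilinear (c x, u x)).comp_of_eq
    (hc.prod hu) rfl

/-- Averaging an analytic function along a continuous path of linear contractions preserves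
analyticity at the origin. -/
theorem AnalyticAt.intervalIntegral_comp_clm {E F : Type*} [NormedAddCommGroup E]
    [NormedSpace ℂ E] [NormedAddCommGroup F] [NormedSpace ℂ F] [CompleteSpace F]
    {f : E → F} (hf : AnalyticAt ℂ f 0) {S : ℝ → E →L[ℂ] E} (hS : Continuous S)
    (hS1 : ∀ s ∈ Set.Ioc (0 : ℝ) 1, ‖S s‖ ≤ 1) :
    AnalyticAt ℂ (fun y => ∫ s in (0 : ℝ)..1, f (S s y)) 0 := by
  obtain ⟨p, r, hp⟩ := hf
  have hSle (s : ℝ) (hs : s ∈ Set.Ioc (0 : ℝ) 1) (y : E) : ‖S s y‖ ≤ ‖y‖ := by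
    simpa using (S s).le_of_opNorm_le (hS1 s hs) y
  have hcont (n : ℕ) : Continuous fun s => (p n).compContinuousLinearMap fun _ => S s := by
    have h := (ContinuousMultilinearMap.compContinuousLinearMapContinuousMultilinear ℂ
      (fun _ : Fin n => E) (fun _ : Fin n => E) F).cont.comp
      (continuous_pi fun _ : Fin n => hS)
    exact h.clm_apply continuous_const
  let q : FormalMultilinearSeries ℂ E F := fun n =>
    ∫ s in (0 : ℝ)..1, (p n).compContinuousLinearMap fun _ => S s
  have hq (n : ℕ) : ‖q n‖ ≤ ‖p n‖ := by
    have h := intervalIntegral.norm_integral_le_of_norm_le_const (a := 0) (b := 1) (C := ‖p n‖)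
      (f := fun s => (p n).compContinuousLinearMap fun _ => S s) (fun s hs => by
        rw [Set.uIoc_of_le zero_le_one] at hs
        refine (ContinuousMultilinearMap.norm_compContinuousLinearMap_le _ _).trans ?_
        exact mul_le_of_le_one_right (norm_nonneg _)
          (Finset.prod_le_one (fun _ _ => norm_nonneg _) fun _ _ => hS1 s hs))
    simpa using h
  have hqa (n : ℕ) (y : E) :
      q n (fun _ => y) = ∫ s in (0 : ℝ)..1, p n fun _ => S s y :=
    ((ContinuousMultilinearMap.apply ℂ (fun _ : Fin n => E) F
      fun _ => y).intervalIntegral_comp_comm ((hcont n).intervalIntegrable 0 1)).symm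
  refine ⟨q, r, ?_, hp.r_pos, ?_⟩
  · exact hp.r_le.trans (FormalMultilinearSeries.radius_le_of_le hq)
  · intro y hy
    have hyr : (‖y‖₊ : ENNReal) < r := by simpa [enorm_eq_nnnorm] using hy
    simp only [zero_add, hqa]
    refine intervalIntegral.hasSum_integral_of_dominated_convergence
      (fun n _ => ‖p n‖ * ‖y‖ ^ n) (fun n => ?_) (fun n => ?_) ?_ ?_ ?_
    · have : Continuous fun s => p n fun _ => S s y :=
        (p n).cont.comp (continuous_pi fun _ => hS.clm_apply continuous_const)
      exact this.aestronglyMeasurable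
    · refine MeasureTheory.ae_of_all _ fun s hs => ?_
      rw [Set.uIoc_of_le zero_le_one] at hs
      refine ((p n).le_opNorm _).trans ?_
      rw [Finset.prod_const, Finset.card_fin]
      exact mul_le_mul_of_nonneg_left (pow_le_pow_left₀ (norm_nonneg _) (hSle s hs y) n)
        (norm_nonneg _)
    · exact MeasureTheory.ae_of_all _ fun s _ => p.summable_norm_mul_pow (r := ‖y‖₊) (hyr.trans_le hp.r_le)
    · exact intervalIntegrable_const
    · refine MeasureTheory.ae_of_all _ fun s hs => ?_
      rw [Set.uIoc_of_le zero_le_one] at hs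
      have hle : ‖S s y‖ ≤ ‖y‖ := hSle s hs y
      have hmem : S s y ∈ Metric.eball (0 : E) r := by
        have : (‖S s y‖₊ : ENNReal) < r := lt_of_le_of_lt (by exact_mod_cast hle) hyr
        simpa [enorm_eq_nnnorm] using this
      simpa only [zero_add] using hp.hasSum hmem

/-- Hadamard's lemma with parameters: an analytic function vanishing on `η = 0` is of the form
`g (x, η) η` with `g` analytic. -/
theorem AnalyticAt.exists_eq_clm_apply_snd {E G F : Type*} [NormedAddCommGroup E]
    [NormedSpace ℂ E] [NormedAddCommGroup G] [NormedSpace ℂ G] [NormedAddCommGroup F]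
    [NormedSpace ℂ F] [CompleteSpace F] {f : E × G → F} (hf : AnalyticAt ℂ f 0)
    (h0 : ∀ᶠ x in 𝓝 (0 : E), f (x, 0) = 0) :
    ∃ g : E × G → G →L[ℂ] F, AnalyticAt ℂ g 0 ∧
      ∀ᶠ p in 𝓝 (0 : E × G), f p = g p p.2 := by
  let S : ℝ → (E × G) →L[ℂ] (E × G) := fun s =>
    (ContinuousLinearMap.inl ℂ E G).comp (ContinuousLinearMap.fst ℂ E G) +
      (s : ℂ) • (ContinuousLinearMap.inr ℂ E G).comp (ContinuousLinearMap.snd ℂ E G)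
  have hSapply (s : ℝ) (p : E × G) : S s p = (p.1, (s : ℂ) • p.2) := by simp [S]
  have hS : Continuous S :=
    continuous_const.add (Complex.continuous_ofReal.smul continuous_const)
  have hSle (s : ℝ) (hs : s ∈ Set.Icc (0 : ℝ) 1) (p : E × G) : ‖S s p‖ ≤ ‖p‖ := by
    rw [hSapply, Prod.norm_def, Prod.norm_def]
    refine max_le_max le_rfl ?_
    rw [norm_smul, Complex.norm_real, Real.norm_of_nonneg hs.1]
    exact mul_le_of_le_one_left (norm_nonneg _) hs.2
  have hS1 (s : ℝ) (hs : s ∈ Set.Ioc (0 : ℝ) 1) : ‖S s‖ ≤ 1 :=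
    ContinuousLinearMap.opNorm_le_bound _ zero_le_one fun p => by
      simpa using hSle s (Set.Ioc_subset_Icc_self hs) p
  let D : E × G → G →L[ℂ] F := fun p => (fderiv ℂ f p).comp (ContinuousLinearMap.inr ℂ E G)
  have hD {p : E × G} (hp : AnalyticAt ℂ f p) : AnalyticAt ℂ D p :=
    (((ContinuousLinearMap.compL ℂ G (E × G) F).flip
      (ContinuousLinearMap.inr ℂ E G)).analyticAt _).comp hp.fderiv
  refine ⟨_, (hD hf).intervalIntegral_comp_clm hS hS1, ?_⟩
  obtain ⟨ε, hε, hball⟩ := Metric.eventually_nhds_iff.1 hf.eventually_analyticAt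
  have h0' : ∀ᶠ p in 𝓝 (0 : E × G), f (p.1, 0) = 0 :=
    (continuous_fst.tendsto' (0 : E × G) 0 rfl).eventually h0
  filter_upwards [h0', Metric.ball_mem_nhds 0 hε] with p hp0 hp
  have han (s : ℝ) (hs : s ∈ Set.Icc (0 : ℝ) 1) : AnalyticAt ℂ f (S s p) := by
    refine hball ?_
    rw [dist_zero_right]
    exact (hSle s hs p).trans_lt (by simpa using hp)
  have hSp : Continuous fun s => S s p := hS.clm_apply continuous_const
  have hDc : ContinuousOn (fun s => D (S s p)) (Set.Icc 0 1) := fun s hs =>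
    ((hD (han s hs)).continuousAt.comp (f := fun s => S s p)
      hSp.continuousAt).continuousWithinAt
  have hint : IntervalIntegrable (fun s => D (S s p)) MeasureTheory.volume 0 1 :=
    ContinuousOn.intervalIntegrable (by rwa [Set.uIcc_of_le zero_le_one])
  have hderiv : ∀ s ∈ Set.uIcc (0 : ℝ) 1,
      HasDerivAt (fun s => f (S s p)) (D (S s p) p.2) s := by
    intro s hs
    rw [Set.uIcc_of_le zero_le_one] at hs
    have h1 : HasDerivAt (fun s : ℝ => S s p) ((0 : E), p.2) s := by
      simp only [hSapply]
      refine (hasDerivAt_const s p.1).prodMk ?_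
      simpa using (Complex.ofRealCLM.hasDerivAt (x := s)).smul_const p.2
    have h2 := ((han s hs).differentiableAt.hasFDerivAt.restrictScalars ℝ).comp_hasDerivAt s h1
    simpa [D, Function.comp_def] using h2
  have hftc := intervalIntegral.integral_eq_sub_of_hasDerivAt hderiv
    (ContinuousOn.intervalIntegrable (by
      rw [Set.uIcc_of_le zero_le_one]
      exact hDc.clm_apply continuousOn_const))
  have hc := (ContinuousLinearMap.apply ℂ F p.2).intervalIntegral_comp_comm hint
  simp only [ContinuousLinearMap.apply_apply] at hc
  rw [← hc, hftc]
  simp [hSapply, hp0]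

theorem AnalyticAt.matrix_det {E n : Type*} [NormedAddCommGroup E] [NormedSpace ℂ E] [Fintype n]
    [DecidableEq n] {M : E → Matrix n n ℂ} {x : E}
    (hM : ∀ i j, AnalyticAt ℂ (fun y => M y i j) x) : AnalyticAt ℂ (fun y => (M y).det) x := by
  simp only [Matrix.det_apply']
  exact Finset.analyticAt_fun_sum _ fun σ _ => analyticAt_const.mul
    (Finset.analyticAt_fun_prod _ fun i _ => hM (σ i) i)

theorem AnalyticAt.matrix_adjugate_apply {E n : Type*} [NormedAddCommGroup E] [NormedSpace ℂ E]
    [Fintype n] [DecidableEq n] {M : E → Matrix n n ℂ} {x : E}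
    (hM : ∀ i j, AnalyticAt ℂ (fun y => M y i j) x) (i j : n) :
    AnalyticAt ℂ (fun y => (M y).adjugate i j) x := by
  simp only [Matrix.adjugate_apply]
  refine AnalyticAt.matrix_det fun a b => ?_
  simp only [Matrix.updateRow_apply]
  split_ifs
  · exact analyticAt_const
  · exact hM a b

/-- A quadratic perturbation of `(x, w) ↦ w` is analytically invertible in `w`, with parameter
`x`. -/
theorem AnalyticAt.exists_inverse_add_quadratic {E G H : Type*} [NormedAddCommGroup E]
    [NormedSpace ℂ E] [CompleteSpace E] [NormedAddCommGroup G] [NormedSpace ℂ G]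
    [CompleteSpace G] [NormedAddCommGroup H] [NormedSpace ℂ H]
    {b : E × G → H →L[ℂ] H →L[ℂ] G} {l : E × G → H} (hb : AnalyticAt ℂ b 0)
    (hl : AnalyticAt ℂ l 0) (hl0 : ∀ x, l (x, 0) = 0) :
    ∃ ψ : E × G → G, AnalyticAt ℂ ψ 0 ∧ (∀ᶠ x in 𝓝 (0 : E), ψ (x, 0) = 0) ∧
      ∀ᶠ p in 𝓝 (0 : E × G),
        ψ p + b (p.1, ψ p) (l (p.1, ψ p)) (l (p.1, ψ p)) = p.2 := by
  let Φ : E × G → E × G := fun p => (p.1, p.2 + b p (l p) (l p))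
  have hΦ : AnalyticAt ℂ Φ 0 :=
    analyticAt_fst.prod (analyticAt_snd.add ((hb.apply_clm hl).apply_clm hl))
  have hl00 : l 0 = 0 := hl0 0
  have hder : HasFDerivAt Φ
      ((ContinuousLinearEquiv.refl ℂ (E × G) : (E × G) ≃L[ℂ] (E × G)) :
        (E × G) →L[ℂ] (E × G)) 0 := by
    have hld := hl.differentiableAt.hasFDerivAt
    have h := hasFDerivAt_fst (𝕜 := ℂ) (p := (0 : E × G)) |>.prodMk
      (hasFDerivAt_snd (𝕜 := ℂ) (p := (0 : E × G)) |>.add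
        ((hb.differentiableAt.hasFDerivAt.clm_apply hld).clm_apply hld))
    refine h.congr_fderiv ?_
    ext <;> simp [hl00]
  have hcd : ContDiffAt ℂ ⊤ Φ 0 := hΦ.contDiffAt
  have hΦ0 : Φ 0 = 0 := by simp [Φ, hl00]
  let Ψ := hcd.localInverse hder (by simp)
  have hΨ : AnalyticAt ℂ Ψ 0 := by
    have := (hcd.to_localInverse hder (by simp)).analyticAt
    rwa [hΦ0] at this
  have hs := hcd.hasStrictFDerivAt' hder (by simp)
  have hright : ∀ᶠ p in 𝓝 (0 : E × G), Φ (Ψ p) = p := by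
    have := hs.eventually_right_inverse
    rwa [hΦ0] at this
  have hleft : ∀ᶠ p in 𝓝 (0 : E × G), Ψ (Φ p) = p := hs.eventually_left_inverse
  refine ⟨fun p => (Ψ p).2, analyticAt_snd.comp hΨ, ?_, ?_⟩
  · have hx : Tendsto (fun x : E => (x, (0 : G))) (𝓝 0) (𝓝 0) :=
      (Continuous.prodMk_left (0 : G)).tendsto' 0 0 rfl
    filter_upwards [hx.eventually hleft] with x hx
    have : Φ (x, 0) = (x, 0) := by simp [Φ, hl0]
    rw [this] at hx
    rw [hx]
  · filter_upwards [hright] with p hp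
    have h1 : (Ψ p).1 = p.1 := (congrArg Prod.fst hp :)
    have h2 : ((p.1, (Ψ p).2) : E × G) = Ψ p := by rw [← h1]
    rw [h2]
    exact congrArg (Prod.snd : E × G → G) hp

theorem stmt_9 (r₁ r₂ N : ℕ) (hN : N ≤ r₂)
    (V : (Fin r₁ → ℂ) → (Fin r₂ → ℂ) → (Fin N → ℂ))
    (hV : AnalyticAt ℂ (fun p : (Fin r₁ → ℂ) × (Fin r₂ → ℂ) => V p.1 p.2) 0)
    (hV0 : ∀ᶠ x in 𝓝 (0 : Fin r₁ → ℂ), V x 0 = 0)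
    (d : (Fin r₁ → ℂ) → ℂ)
    (hd : d = fun x => Matrix.det
      (Matrix.of fun i j : Fin N =>
        fderiv ℂ (fun ξ : Fin r₂ → ℂ => V x ξ i) 0 (Pi.single (Fin.castLE hN j) 1)))
    (hdne : ∃ᶠ x in 𝓝 (0 : Fin r₁ → ℂ), d x ≠ 0) :
    ∃ (δ : (Fin r₁ → ℂ) → ℂ) (φ : (Fin r₁ → ℂ) × (Fin N → ℂ) → (Fin r₂ → ℂ)),
      AnalyticAt ℂ δ 0 ∧ AnalyticAt ℂ φ 0 ∧
      (∃ᶠ x in 𝓝 (0 : Fin r₁ → ℂ), δ x ≠ 0) ∧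
      (∀ᶠ x in 𝓝 (0 : Fin r₁ → ℂ), φ (x, 0) = 0 ∧ δ x = (d x) ^ 2) ∧
      ∃ ε > (0 : ℝ), ∀ (x : Fin r₁ → ℂ) (Z : Fin N → ℂ),
        ‖x‖ < ε → δ x ≠ 0 → ‖(δ x)⁻¹ • Z‖ < ε →
          V x (φ (x, (δ x)⁻¹ • Z)) = Z := by
  let E := Fin r₁ → ℂ
  let G := Fin N → ℂ
  let H := Fin r₂ → ℂ
  obtain ⟨g, hg, hgV⟩ := hV.exists_eq_clm_apply_snd hV0
  have hxη : Tendsto (fun x : E => (x, (0 : H))) (𝓝 0) (𝓝 0) :=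
    (Continuous.prodMk_left (0 : H)).tendsto' 0 0 rfl
  have hg0 : AnalyticAt ℂ (fun x : E => g (x, 0)) 0 :=
    hg.comp_of_eq (analyticAt_id.prod analyticAt_const) rfl
  have hg1 : AnalyticAt ℂ (fun p : E × H => g p - g (p.1, 0)) 0 :=
    hg.sub (hg0.comp_of_eq analyticAt_fst rfl)
  obtain ⟨B, hB, hBg⟩ := hg1.exists_eq_clm_apply_snd (by simp)
  let e : Fin N → H := fun j => Pi.single (Fin.castLE hN j) 1
  let J : G →L[ℂ] H :=
    ∑ j, (ContinuousLinearMap.proj (R := ℂ) (φ := fun _ : Fin N => ℂ) j).smulRight (e j)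
  let M : E → Matrix (Fin N) (Fin N) ℂ := fun x => Matrix.of fun i j => g (x, 0) (e j) i
  have hM (i j : Fin N) : AnalyticAt ℂ (fun x => M x i j) 0 :=
    ((ContinuousLinearMap.proj (R := ℂ) (φ := fun _ : Fin N => ℂ) i).analyticAt _).comp
      (hg0.apply_clm analyticAt_const)
  have hgJ (x : E) (u : G) : g (x, 0) (J u) = (M x).mulVec u := by
    ext i
    simp only [J, M, sum_apply, ContinuousLinearMap.smulRight_apply, map_sum,
      map_smul, Finset.sum_apply, Pi.smul_apply, smul_eq_mul, Matrix.mulVec, dotProduct,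
      Matrix.of_apply]
    exact Finset.sum_congr rfl fun j _ => mul_comm _ _
  have hdet : AnalyticAt ℂ (fun x => (M x).det) 0 := AnalyticAt.matrix_det hM
  have hdM : ∀ᶠ x in 𝓝 (0 : E), (M x).det = d x := by
    filter_upwards [hxη.eventually hgV.eventually_nhds,
      hxη.eventually hg.eventually_analyticAt] with x hx hgx
    have hxc : Tendsto (fun ξ : H => (x, ξ)) (𝓝 0) (𝓝 (x, 0)) :=
      (Continuous.prodMk_right x).tendsto' 0 _ rfl
    have hgd : HasFDerivAt (fun ξ : H => g (x, ξ))
        (fderiv ℂ (fun ξ : H => g (x, ξ)) 0) 0 :=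
      (hgx.comp_of_eq (f := fun ξ : H => (x, ξ)) (analyticAt_const.prod analyticAt_id)
        rfl).differentiableAt.hasFDerivAt
    have hVd : HasFDerivAt (fun ξ : H => V x ξ) (g (x, 0)) 0 := by
      have h := hgd.clm_apply (hasFDerivAt_id (0 : H))
      refine (h.congr_of_eventuallyEq (hxc.eventually hx)).congr_fderiv ?_
      ext; simp
    rw [hd]
    refine congrArg Matrix.det ?_
    ext i j
    have := (hasFDerivAt_pi'.1 hVd i).fderiv
    simp only [Matrix.of_apply, M]
    exact (DFunLike.congr_fun this (e j)).symm
  let l : E × G → H := fun p => J ((M p.1).adjugate.mulVec p.2)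
  have hl : AnalyticAt ℂ l 0 := by
    refine (J.analyticAt _).comp (analyticAt_pi_iff.2 fun i => ?_)
    simp only [Matrix.mulVec, dotProduct]
    refine Finset.analyticAt_fun_sum _ fun j _ => AnalyticAt.mul ?_ ?_
    · exact (AnalyticAt.matrix_adjugate_apply hM i j).comp_of_eq analyticAt_fst rfl
    · exact ((ContinuousLinearMap.proj (R := ℂ) (φ := fun _ : Fin N => ℂ) j).analyticAt _).comp
        analyticAt_snd
  have hl0 (x : E) : l (x, 0) = 0 := by simp [l]
  let ξ : E × G → H := fun p => (M p.1).det • l p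
  have hξ : AnalyticAt ℂ ξ 0 := (hdet.comp_of_eq analyticAt_fst rfl).smul hl
  have hξ0 (x : E) : ξ (x, 0) = 0 := by simp [ξ, hl0]
  have hξp : AnalyticAt ℂ (fun p : E × G => (p.1, ξ p)) 0 := analyticAt_fst.prod hξ
  have hξp0 : ((0 : E × G).1, ξ 0) = 0 := Prod.ext rfl (hξ0 0)
  have hb : AnalyticAt ℂ (fun p : E × G => B (p.1, ξ p)) 0 := hB.comp_of_eq hξp hξp0
  obtain ⟨ψ, hψ, hψ0, hψe⟩ := hb.exists_inverse_add_quadratic hl hl0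
  have hψp : AnalyticAt ℂ (fun p : E × G => (p.1, ψ p)) 0 := analyticAt_fst.prod hψ
  have hψp0 : ((0 : E × G).1, ψ 0) = 0 := Prod.ext rfl hψ0.self_of_nhds
  have hφ : AnalyticAt ℂ (fun p : E × G => ξ (p.1, ψ p)) 0 := hξ.comp_of_eq hψp hψp0
  have hφ0 : Tendsto (fun p : E × G => (p.1, ξ (p.1, ψ p))) (𝓝 0) (𝓝 0) := by
    have h : ((0 : E × G).1, ξ ((0 : E × G).1, ψ 0)) = 0 := by rw [hψp0]; exact hξp0
    have h' := (analyticAt_fst.prod hφ).continuousAt.tendsto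
    rwa [h] at h'
  refine ⟨fun x => (M x).det ^ 2, fun p => ξ (p.1, ψ p), hdet.pow 2, hφ, ?_, ?_, ?_⟩
  · refine (hdne.and_eventually hdM).mono fun x hx => ?_
    change (M x).det ^ 2 ≠ 0
    rw [hx.2]
    exact pow_ne_zero 2 hx.1
  · filter_upwards [hψ0, hdM] with x hx hx'
    exact ⟨by rw [hx]; exact hξ0 x, congrArg (· ^ 2) hx'⟩
  · have key : ∀ᶠ p in 𝓝 (0 : E × G), V p.1 (ξ (p.1, ψ p)) = (M p.1).det ^ 2 • p.2 := by
      filter_upwards [hφ0.eventually hgV, hφ0.eventually hBg, hψe] with p h1 h2 h3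
      replace h2 := sub_eq_iff_eq_add.1 h2
      change V p.1 (ξ (p.1, ψ p)) = _ at h1
      change ψ p + B (p.1, ξ (p.1, ψ p)) _ _ = _ at h3
      rw [h1, h2, ← h3]
      set w := ψ p
      have h4 : g (p.1, 0) (l (p.1, w)) = (M p.1).det • w := by
        simp only [l, hgJ, Matrix.mulVec_mulVec, Matrix.mul_adjugate, Matrix.smul_mulVec,
          Matrix.one_mulVec]
      set b := B (p.1, ξ (p.1, w))
      have h5 : ξ (p.1, w) = (M p.1).det • l (p.1, w) := rfl
      rw [h5]
      simp only [add_apply, map_smul, smul_apply, h4]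
      module
    obtain ⟨ε, hε, hball⟩ := Metric.eventually_nhds_iff.1 key
    refine ⟨ε, hε, fun x Z hx hδ hZ => ?_⟩
    have h := hball (y := (x, ((M x).det ^ 2)⁻¹ • Z)) (by
      rw [dist_zero_right, Prod.norm_def]
      exact max_lt hx hZ)
    rw [h, smul_inv_smul₀ hδ]
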